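/- Let T be a regular Morse tile of dimension n and order k, with underlying simplex σ, restriction set R and nonempty Morse face μ with R ⊊ μ, and set l = dim(μ) = card(μ)−1, so that k ≤ l. Let θ be a face of σ of positive dimension with μ ⊊ θ. Then the stellar subdivision of T at θ carries a Morse shelling using exactly two critical tiles, of consecutive indices l and l+1, together with exactly (l − k) regular Morse tiles whose Morse faces have dimension l−1 and whose orders are exactly k, k+1, …, l−1, all remaining tiles being regular basic tiles. -/

import Mathlib

open Finset

variable {V : Type*} [DecidableEq V]

/-- A finite simplicial complex: a finite collection of finite sets of vertices
closed under taking subsets. -/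
def IsComplex (K : Finset (Finset V)) : Prop :=
  ∀ σ ∈ K, ∀ τ ⊆ σ, τ ∈ K

/-- The set of nonempty faces of the relative simplicial complex `K ∖ L`. -/
def relFaces (K L : Finset (Finset V)) : Finset (Finset V) :=
  (K \ L).filter (fun τ => τ ≠ ∅)

/-- A set `A` of faces is closed in `S`: every nonempty face of `S` contained in a
member of `A` belongs to `A`. -/
def closedIn (S A : Finset (Finset V)) : Prop :=
  ∀ τ ∈ S, τ ≠ ∅ → ∀ α ∈ A, τ ⊆ α → τ ∈ A

/-- A facet: a maximal face. -/
def IsFacetOf (K : Finset (Finset V)) (θ : Finset V) : Prop :=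
  θ ∈ K ∧ ∀ σ ∈ K, θ ⊆ σ → σ = θ

instance (K : Finset (Finset V)) (θ : Finset V) : Decidable (IsFacetOf K θ) :=
  inferInstanceAs (Decidable (θ ∈ K ∧ ∀ σ ∈ K, θ ⊆ σ → σ = θ))

/-- A ridge: a face of codimension one in every facet containing it. -/
def IsRidgeOf (K : Finset (Finset V)) (θ : Finset V) : Prop :=
  θ ∈ K ∧ ∀ σ, IsFacetOf K σ → θ ⊆ σ → σ.card = θ.card + 1

/-- Stellar subdivision of `K` at the face `θ`, using the new vertex `v`. -/
def stellar (K : Finset (Finset V)) (θ : Finset V) (v : V) : Finset (Finset V) :=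
  K.filter (fun σ => ¬ θ ⊆ σ) ∪
    (K.filter (fun ρ => ¬ θ ⊆ ρ ∧ ρ ∪ θ ∈ K)).image (fun ρ => insert v ρ)

/-- Barycentric subdivision: faces are the chains of nonempty faces of `K`. -/
def barySd (K : Finset (Finset V)) : Finset (Finset (Finset V)) :=
  K.powerset.filter (fun c => ∅ ∉ c ∧ ∀ τ ∈ c, ∀ τ' ∈ c, τ ⊆ τ' ∨ τ' ⊆ τ)

/-- A Morse tile: a simplex `simplex` deprived of the ridges not containing `res`,
together possibly with a Morse face `morse` of higher codimension. -/
structure MorseTile (V : Type*) where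
  simplex : Finset V
  res : Finset V
  morse : Option (Finset V)
  simplex_nonempty : simplex.Nonempty
  res_sub : res ⊆ simplex
  morse_res : ∀ μ ∈ morse, res ⊆ μ
  morse_ssub : ∀ μ ∈ morse, μ ⊂ simplex
  morse_card : ∀ μ ∈ morse, μ.card + 2 ≤ simplex.card

namespace MorseTile

/-- The face set of a Morse tile. -/
def faceSet (T : MorseTile V) : Finset (Finset V) :=
  match T.morse with
  | none => T.simplex.powerset.filter (fun τ => T.res ⊆ τ ∧ τ ≠ ∅)
  | some μ => T.simplex.powerset.filter (fun τ => T.res ⊆ τ ∧ ¬ τ ⊆ μ)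

/-- The dimension of a Morse tile. -/
def dim (T : MorseTile V) : ℕ := T.simplex.card - 1

/-- The order of a Morse tile. -/
def order (T : MorseTile V) : ℕ := T.res.card

/-- The index of a (critical) Morse tile. -/
def index (T : MorseTile V) : ℕ :=
  if T.res = T.simplex then T.simplex.card - 1 else T.res.card

/-- Basic tiles: no Morse face. -/
def IsBasic (T : MorseTile V) : Prop := T.morse = none

/-- Critical tiles: the Morse face equals the restriction set, or the open simplex. -/
def IsCritical (T : MorseTile V) : Prop := T.morse = some T.res ∨ T.res = T.simplex

/-- Tiles allowed in an h-tiling: basic or critical tiles. -/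
def IsHTile (T : MorseTile V) : Prop := T.morse = none ∨ T.morse = some T.res

/-- The closed simplex. -/
def IsClosedSimplex (T : MorseTile V) : Prop := T.morse = none ∧ T.res = ∅

/-- The open simplex. -/
def IsOpenSimplex (T : MorseTile V) : Prop := T.morse = none ∧ T.res = T.simplex

instance (T : MorseTile V) : Decidable T.IsCritical :=
  inferInstanceAs (Decidable (T.morse = some T.res ∨ T.res = T.simplex))

/-- Isomorphism of Morse tiles: a bijection between the underlying simplices mapping
the face set of one onto the face set of the other. -/
def Isom (T T' : MorseTile V) : Prop :=
  ∃ e : V → V, Set.InjOn e (T.simplex : Set V) ∧ T.simplex.image e = T'.simplex ∧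
    T.faceSet.image (fun τ => τ.image e) = T'.faceSet

/-- The subcomplex `L_T` of removed faces of a Morse tile. -/
def removed (T : MorseTile V) : Finset (Finset V) :=
  T.simplex.powerset.filter (fun τ => τ ∉ T.faceSet)

/-- The stellar subdivision of a Morse tile at a face `θ` of its underlying simplex,
as a relative simplicial complex. -/
def stellarSub (T : MorseTile V) (θ : Finset V) (v : V) : Finset (Finset V) :=
  relFaces (stellar T.simplex.powerset θ v) (stellar T.removed θ v)

end MorseTile

/-- The union of the face sets of a list of Morse tiles. -/
def faceUnion (ts : List (MorseTile V)) : Finset (Finset V) :=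
  ts.foldr (fun T A => T.faceSet ∪ A) ∅

/-- A Morse tiling of the set `S` of nonempty faces of a relative complex:
the face sets of the tiles partition `S`, and for every `d` the union of the
face sets of the tiles of dimension at least `d` is closed in `S`. -/
def IsMorseTiling (S : Finset (Finset V)) (ts : List (MorseTile V)) : Prop :=
  ts.Pairwise (fun T T' => Disjoint T.faceSet T'.faceSet) ∧
  faceUnion ts = S ∧
  ∀ d : ℕ, closedIn S (faceUnion (ts.filter (fun T => decide (d ≤ T.dim))))

/-- A Morse shelling: a Morse tiling whose order makes every initial union closed. -/
def IsMorseShelling (S : Finset (Finset V)) (ts : List (MorseTile V)) : Prop :=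
  IsMorseTiling S ts ∧ ∀ p : ℕ, closedIn S (faceUnion (ts.take p))

/-- An h-tiling: a Morse tiling all of whose tiles are basic or critical. -/
def IsHTiling (S : Finset (Finset V)) (ts : List (MorseTile V)) : Prop :=
  IsMorseTiling S ts ∧ ∀ T ∈ ts, T.IsHTile

/-- A shellable (shelled) h-tiling. -/
def IsHShelling (S : Finset (Finset V)) (ts : List (MorseTile V)) : Prop :=
  IsMorseShelling S ts ∧ ∀ T ∈ ts, T.IsHTile

/-- The number of critical tiles of index `k`. -/
def criticalCount (ts : List (MorseTile V)) (k : ℕ) : ℕ :=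
  ts.countP (fun T => decide (T.IsCritical ∧ T.index = k))

/-- The total number of critical tiles. -/
def totalCritical (ts : List (MorseTile V)) : ℕ :=
  ts.countP (fun T => decide T.IsCritical)

/-- The number of tiles of order `k`. -/
def hCount (ts : List (MorseTile V)) (k : ℕ) : ℕ :=
  ts.countP (fun T => decide (T.order = k))

/-- The number of `k`-dimensional faces. -/
def fCount (S : Finset (Finset V)) (k : ℕ) : ℕ :=
  (S.filter (fun τ => τ.card = k + 1)).card

/-- The Euler characteristic of a set of nonempty faces. -/
def eulerChar (S : Finset (Finset V)) : ℤ :=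
  ∑ τ ∈ S, (-1 : ℤ) ^ (τ.card - 1)

/-- A pure `n`-dimensional complex: it has an `n`-dimensional face and all its
facets have dimension `n`. -/
def IsPureDim (n : ℕ) (K : Finset (Finset V)) : Prop :=
  (∃ σ ∈ K, σ.card = n + 1) ∧ ∀ θ, IsFacetOf K θ → θ.card = n + 1

/-- A closed `n`-dimensional pseudo-manifold: a pure `n`-dimensional complex in
which every `(n-1)`-dimensional face is contained in exactly two facets. -/
def IsPseudoManifold (n : ℕ) (K : Finset (Finset V)) : Prop :=
  IsComplex K ∧ IsPureDim n K ∧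
  ∀ ρ ∈ K, ρ.card = n → (K.filter (fun σ => IsFacetOf K σ ∧ ρ ⊆ σ)).card = 2

/-- Strong connectedness: any two facets are joined by a sequence of facets in which
consecutive ones share an `(n-1)`-dimensional face. -/
def StronglyConnected (n : ℕ) (K : Finset (Finset V)) : Prop :=
  ∀ σ σ', IsFacetOf K σ → IsFacetOf K σ' →
    ∃ (m : ℕ) (c : ℕ → Finset V), c 0 = σ ∧ c m = σ' ∧
      (∀ i ≤ m, IsFacetOf K (c i)) ∧
      ∀ i < m, ∃ ρ : Finset V, ρ.card = n ∧ ρ ⊆ c i ∧ ρ ⊆ c (i + 1)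

/-- Classical shellability of a finite simplicial complex. -/
def ClassicallyShellable (K : Finset (Finset V)) : Prop :=
  ∃ (N : ℕ) (f : Fin N → Finset V), Function.Injective f ∧
    (∀ σ, IsFacetOf K σ ↔ ∃ i, f i = σ) ∧
    ∀ p : Fin N, 0 < (p : ℕ) →
      ∃ R : Finset V, R ≠ ∅ ∧ R ⊆ f p ∧
        ∀ τ : Finset V,
          ((τ ≠ ∅ ∧ τ ⊆ f p ∧ ∀ q, q < p → ¬ τ ⊆ f q) ↔ (R ⊆ τ ∧ τ ⊆ f p))

theorem mem_faceUnion (ts : List (MorseTile V)) (τ : Finset V) :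
    τ ∈ faceUnion ts ↔ ∃ T ∈ ts, τ ∈ T.faceSet := by
  induction ts with
  | nil => simp [faceUnion]
  | cons T ts ih =>
    have h : faceUnion (T :: ts) = T.faceSet ∪ faceUnion ts := rfl
    simp [h, ih]

namespace MorseTile

theorem mem_faceSet_of_morse_eq_none {T : MorseTile V} (h : T.morse = none) (τ : Finset V) :
    τ ∈ T.faceSet ↔ τ ⊆ T.simplex ∧ T.res ⊆ τ ∧ τ ≠ ∅ := by
  simp [faceSet, h]

theorem mem_faceSet_of_morse_eq_some {T : MorseTile V} {μ : Finset V} (h : T.morse = some μ)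
    (τ : Finset V) : τ ∈ T.faceSet ↔ τ ⊆ T.simplex ∧ T.res ⊆ τ ∧ ¬ τ ⊆ μ := by
  simp [faceSet, h]

/-- The faces of the stellar subdivision of a Morse tile at a face strictly containing its
Morse face. -/
theorem mem_stellarSub_iff {T : MorseTile V} {μ θ : Finset V} {v : V}
    (hmorse : T.morse = some μ) (hθ : θ ⊆ T.simplex) (hμθ : μ ⊂ θ) (hv : v ∉ T.simplex)
    (τ : Finset V) :
    τ ∈ T.stellarSub θ v ↔
      τ ⊆ insert v T.simplex ∧ ¬ θ ⊆ τ ∧ (v ∉ τ → T.res ⊆ τ ∧ ¬ τ ⊆ μ) := by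
  have hRμ : T.res ⊆ μ := T.morse_res μ hmorse
  have hvθ : v ∉ θ := fun h => hv (hθ h)
  have hremoved : ∀ ρ, ρ ∈ T.removed ↔ ρ ⊆ T.simplex ∧ (T.res ⊆ ρ → ρ ⊆ μ) := by
    intro ρ
    simp only [removed, Finset.mem_filter, Finset.mem_powerset,
      mem_faceSet_of_morse_eq_some hmorse]
    tauto
  have hnot : ∀ ρ, θ ⊆ ρ → ρ ∉ T.removed := by
    intro ρ hρ h
    exact hμθ.2 (hρ.trans (((hremoved ρ).1 h).2 (hRμ.trans (hμθ.1.trans hρ))))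
  have hstellar : stellar T.removed θ v = T.removed := by
    ext ρ
    simp only [stellar, Finset.mem_union, Finset.mem_filter, Finset.mem_image]
    constructor
    · rintro (⟨h, -⟩ | ⟨ρ', ⟨-, -, h⟩, -⟩)
      · exact h
      · exact absurd h (hnot _ Finset.subset_union_right)
    · exact fun h => Or.inl ⟨h, fun hρ => hnot ρ hρ h⟩
  simp only [stellarSub, relFaces, hstellar, Finset.mem_filter, Finset.mem_sdiff, hremoved]
  simp only [stellar, Finset.mem_union, Finset.mem_filter, Finset.mem_image, Finset.mem_powerset]
  constructor
  · rintro ⟨⟨⟨h, h'⟩ | ⟨ρ, ⟨h, h', -⟩, rfl⟩, hr⟩, -⟩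
    · exact ⟨h.trans (Finset.subset_insert _ _), h', fun _ => by tauto⟩
    · refine ⟨Finset.insert_subset_insert _ h, fun hρ => h' ?_, fun hv' => ?_⟩
      · exact (Finset.subset_insert_iff_of_notMem hvθ).1 hρ
      · exact absurd (Finset.mem_insert_self _ _) hv'
  · rintro ⟨h, h', hr⟩
    by_cases hvτ : v ∈ τ
    · refine ⟨⟨Or.inr ⟨τ.erase v, ⟨Finset.subset_insert_iff.1 h, fun hρ => h'
        (hρ.trans (Finset.erase_subset _ _)), Finset.union_subset (Finset.subset_insert_iff.1 h) hθ⟩,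
        Finset.insert_erase hvτ⟩, fun hs => hv (hs.1 hvτ)⟩, ?_⟩
      exact Finset.ne_empty_of_mem hvτ
    · obtain ⟨h1, h2⟩ := hr hvτ
      refine ⟨⟨Or.inl ⟨(Finset.subset_insert_iff_of_notMem hvτ).1 h, h'⟩, by tauto⟩, ?_⟩
      rintro rfl
      exact h2 (Finset.empty_subset _)

end MorseTile

/-- An enumeration of a finite set extends to an enumeration of any larger finite set. -/
theorem exists_enumeration_extending {s t : Finset V} (hst : s ⊆ t) (f : ℕ → V)
    (hinj : Set.InjOn f (Set.Iio s.card)) (him : (Finset.range s.card).image f = s) :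
    ∃ g : ℕ → V, Set.EqOn g f (Set.Iio s.card) ∧ Set.InjOn g (Set.Iio t.card) ∧
      (Finset.range t.card).image g = t := by
  obtain ⟨u, rfl⟩ : ∃ u, t = u ∪ s := ⟨t, (Finset.union_eq_left.2 hst).symm⟩
  clear hst
  induction u using Finset.induction_on with
  | empty => exact ⟨f, fun _ _ => rfl, by simpa using hinj, by simpa using him⟩
  | insert x u _ ih =>
    obtain ⟨g, hgf, hg, hgi⟩ := ih
    rw [Finset.insert_union]
    by_cases hx : x ∈ u ∪ s
    · rw [Finset.insert_eq_of_mem hx]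
      exact ⟨g, hgf, hg, hgi⟩
    · rw [Finset.card_insert_of_notMem hx]
      set N := (u ∪ s).card with hN
      have hsN : s.card ≤ N := Finset.card_le_card Finset.subset_union_right
      have hmem : ∀ i < N, g i ∈ u ∪ s := fun i hi => by
        rw [← hgi]
        exact Finset.mem_image_of_mem _ (Finset.mem_range.2 hi)
      have hne : ∀ i < N, g i ≠ x := fun i hi h => hx (h ▸ hmem i hi)
      have hup : ∀ i < N, Function.update g N x i = g i := fun i hi =>
        Function.update_of_ne hi.ne _ _
      refine ⟨Function.update g N x, ?_, ?_, ?_⟩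
      · intro i hi
        have hi' : i < s.card := hi
        rw [hup i (by omega)]
        exact hgf hi
      · intro i hi j hj hij
        simp only [Set.mem_Iio] at hi hj
        rcases Nat.lt_succ_iff_lt_or_eq.1 hi with hi | rfl <;>
          rcases Nat.lt_succ_iff_lt_or_eq.1 hj with hj | rfl
        · rw [hup i hi, hup j hj] at hij
          exact hg hi hj hij
        · rw [hup i hi, Function.update_self] at hij
          exact absurd hij (hne i hi)
        · rw [hup j hj, Function.update_self] at hij
          exact absurd hij.symm (hne j hj)
        · rfl
      · rw [Finset.range_add_one, Finset.image_insert, Function.update_self]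
        congr 1
        rw [← hgi]
        exact Finset.image_congr fun i hi => hup i (Finset.mem_range.1 hi)

/-- A flag of finite sets has a common enumeration. -/
theorem exists_enumeration_flag [Nonempty V] {r s t : Finset V} (hrs : r ⊆ s) (hst : s ⊆ t) :
    ∃ f : ℕ → V, Set.InjOn f (Set.Iio t.card) ∧ (Finset.range r.card).image f = r ∧
      (Finset.range s.card).image f = s ∧ (Finset.range t.card).image f = t := by
  obtain ⟨f, -, hf, hfr⟩ := exists_enumeration_extending (Finset.empty_subset r)
    (fun _ => Classical.arbitrary V) (by simp) (by simp)
  obtain ⟨g, hgf, hg, hgs⟩ := exists_enumeration_extending hrs f hf hfr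
  obtain ⟨h, hhg, hh, hht⟩ := exists_enumeration_extending hst g hg hgs
  have hcard := Finset.card_le_card hrs
  refine ⟨h, hh, Eq.trans (Finset.image_congr fun i hi => ?_) hfr,
    Eq.trans (Finset.image_congr fun i hi => ?_) hgs, hht⟩
  · have hi' : i < r.card := Finset.mem_range.1 hi
    exact (hhg (show i < s.card by omega)).trans (hgf hi')
  · exact hhg (Finset.mem_range.1 hi)

/-- A criterion for tiles sorted by the first vertex, in a given enumeration, missing from a face
to form a Morse shelling. -/
theorem isMorseShelling_of_first_missing_vertex {S : Finset (Finset V)} (f : ℕ → V) (M n : ℕ)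
    (t : ℕ → MorseTile V)
    (hface : ∀ i < M, ∀ τ, τ ∈ (t i).faceSet ↔ τ ∈ S ∧ (∀ j < i, f j ∈ τ) ∧ f i ∉ τ)
    (hdim : ∀ i < M, (t i).dim = n) (hmiss : ∀ τ ∈ S, ∃ i < M, f i ∉ τ) :
    IsMorseShelling S ((List.range M).map t) := by
  have hunion : ∀ p ≤ M, ∀ τ,
      τ ∈ faceUnion ((List.range p).map t) ↔ τ ∈ S ∧ ∃ i < p, f i ∉ τ := by
    intro p hp τ
    simp only [mem_faceUnion, List.mem_map, List.mem_range]
    constructor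
    · rintro ⟨_, ⟨i, hi, rfl⟩, hτ⟩
      obtain ⟨h1, -, h3⟩ := (hface i (by omega) τ).1 hτ
      exact ⟨h1, i, hi, h3⟩
    · rintro ⟨hS, hex⟩
      classical
      obtain ⟨hi, hf⟩ := Nat.find_spec hex
      refine ⟨_, ⟨Nat.find hex, hi, rfl⟩, (hface _ (by omega) τ).2 ⟨hS, fun j hj => ?_, hf⟩⟩
      by_contra hj'
      exact Nat.find_min hex hj ⟨by omega, hj'⟩
  have hall : faceUnion ((List.range M).map t) = S := by
    ext τ
    rw [hunion M le_rfl]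
    exact ⟨fun h => h.1, fun h => ⟨h, hmiss τ h⟩⟩
  refine ⟨⟨?_, hall, ?_⟩, ?_⟩
  · rw [List.pairwise_map]
    refine List.Pairwise.imp_of_mem ?_ List.pairwise_lt_range
    intro i j hi hj hij
    rw [Finset.disjoint_left]
    intro τ h1 h2
    exact ((hface i (List.mem_range.1 hi) τ).1 h1).2.2
      (((hface j (List.mem_range.1 hj) τ).1 h2).2.1 i hij)
  · intro d τ hτ _ α hα _
    obtain ⟨T, hT, -⟩ := (mem_faceUnion _ _).1 hα
    have hd : d ≤ n := by
      obtain ⟨hT1, hT2⟩ := List.mem_filter.1 hT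
      obtain ⟨i, hi, rfl⟩ := List.mem_map.1 hT1
      rw [hdim i (List.mem_range.1 hi)] at hT2
      simpa using hT2
    rw [List.filter_eq_self.2, hall]
    · exact hτ
    · intro T hT
      obtain ⟨i, hi, rfl⟩ := List.mem_map.1 hT
      simpa [hdim i (List.mem_range.1 hi)] using hd
  · intro p τ hτ _ α hα hsub
    rw [← List.map_take, List.take_range] at hα ⊢
    rw [hunion _ (min_le_right _ _)] at hα ⊢
    obtain ⟨-, i, hi, hf⟩ := hα
    exact ⟨hτ, i, hi, fun h => hf (hsub h)⟩

/-- stellar subdivision of a regular Morse tile at a face strictly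
containing its Morse face. -/
theorem stellar_subdivision_at_face_containing_morse_face {V : Type*} [DecidableEq V]
    (n k l : ℕ) (T : MorseTile V) (μ : Finset V)
    (hdim : T.dim = n) (hord : T.order = k)
    (hmorse : T.morse = some μ) (hRμ : T.res ⊂ μ) (hl : μ.card = l + 1)
    (θ : Finset V) (hθ : θ ⊆ T.simplex) (hμθ : μ ⊂ θ)
    (v : V) (hv : v ∉ T.simplex) :
    ∃ (ts : List (MorseTile V)) (C₁ C₂ : MorseTile V) (ms bs : List (MorseTile V)),
      IsMorseShelling (T.stellarSub θ v) ts ∧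
      ts.Perm (C₁ :: C₂ :: (ms ++ bs)) ∧
      C₁.IsCritical ∧ C₁.index = l ∧
      C₂.IsCritical ∧ C₂.index = l + 1 ∧
      (∀ T' ∈ ms, ¬ T'.IsCritical ∧ ¬ T'.IsBasic ∧ ∀ μ' ∈ T'.morse, μ'.card = l) ∧
      (ms.map MorseTile.order).Perm (List.range' k (l - k)) ∧
      (∀ T' ∈ bs, T'.IsBasic ∧ ¬ T'.IsCritical) := by
  have hRμ' := hRμ.1
  have hvμ : v ∉ μ := fun h => hv (hθ (hμθ.1 h))
  have hvθ : v ∉ θ := fun h => hv (hθ h)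
  have hk : T.res.card = k := hord
  have hkl : k < l + 1 := by rw [← hk, ← hl]; exact Finset.card_lt_card hRμ
  have hlM : l + 1 < θ.card := by rw [← hl]; exact Finset.card_lt_card hμθ
  have hσμ : l + 3 ≤ T.simplex.card := by
    have := T.morse_card μ hmorse
    omega
  have : Nonempty V := ⟨v⟩
  obtain ⟨f, hf, hfR, hfμ, hfθ⟩ := exists_enumeration_flag hRμ' hμθ.1
  rw [hk] at hfR
  rw [hl] at hfμ
  set M := θ.card with hM
  have hfθmem : ∀ i < M, f i ∈ θ := fun i hi => by
    rw [← hfθ]; exact Finset.mem_image_of_mem _ (Finset.mem_range.2 hi)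
  have hfμmem : ∀ i < M, (f i ∈ μ ↔ i < l + 1) := fun i hi => by
    rw [← hfμ, Finset.mem_image]
    constructor
    · rintro ⟨j, hj, hij⟩
      have hj' := Finset.mem_range.1 hj
      rwa [← hf (show j < M by omega) hi hij]
    · exact fun h => ⟨i, Finset.mem_range.2 h, rfl⟩
  have hfRmem : ∀ i < k, f i ∈ T.res := fun i hi => by
    rw [← hfR]; exact Finset.mem_image_of_mem _ (Finset.mem_range.2 hi)
  have hfv : ∀ i < M, f i ≠ v := fun i hi h => hvθ (h ▸ hfθmem i hi)
  have hsubset : ∀ (i : ℕ) (τ : Finset V),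
      (Finset.range i).image f ⊆ τ ↔ ∀ j < i, f j ∈ τ := by
    intro i τ
    simp [Finset.image_subset_iff]
  have hcardA : ∀ i ≤ M, ((Finset.range i).image f).card = i := fun i hi => by
    rw [Finset.card_image_of_injOn, Finset.card_range]
    exact hf.mono fun j hj => lt_of_lt_of_le (Finset.mem_range.1 hj) hi
  have hcardσ : ∀ i < M, (insert v (T.simplex.erase (f i))).card = T.simplex.card := by
    intro i hi
    rw [Finset.card_insert_of_notMem (fun h => hv (Finset.mem_of_mem_erase h)),
      Finset.card_erase_of_mem (hθ (hfθmem i hi))]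
    omega
  have hAσ : ∀ i < M, (Finset.range i).image f ⊆ T.simplex.erase (f i) := by
    intro i hi
    rw [hsubset]
    intro j hj
    refine Finset.mem_erase.2 ⟨fun h => ?_, hθ (hfθmem j (by omega))⟩
    exact hj.ne (hf (show j < M by omega) hi h)
  have hvA : ∀ i ≤ M, v ∉ (Finset.range i).image f := by
    intro i hi h
    obtain ⟨j, hj, hjv⟩ := Finset.mem_image.1 h
    exact hfv j (lt_of_lt_of_le (Finset.mem_range.1 hj) hi) hjv
  have htile : ∀ i : ℕ, ∃ t : MorseTile V, i < M →
      t.simplex = insert v (T.simplex.erase (f i)) ∧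
      t.res = (if i < k then insert v ((Finset.range i).image f) else (Finset.range i).image f) ∧
      t.morse = (if k ≤ i ∧ i ≤ l + 1 then some (μ.erase (f i)) else none) := by
    intro i
    by_cases hi : i < M
    swap
    · exact ⟨T, fun h => absurd h hi⟩
    have hcardμ : (μ.erase (f i)).card + 2 ≤ (insert v (T.simplex.erase (f i))).card := by
      have := Finset.card_le_card (Finset.erase_subset (f i) μ)
      rw [hcardσ i hi]
      omega
    refine ⟨⟨insert v (T.simplex.erase (f i)),
      if i < k then insert v ((Finset.range i).image f) else (Finset.range i).image f,
      if k ≤ i ∧ i ≤ l + 1 then some (μ.erase (f i)) else none,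
      Finset.insert_nonempty _ _, ?_, ?_, ?_, ?_⟩, fun _ => ⟨rfl, rfl, rfl⟩⟩
    · split_ifs
      · exact Finset.insert_subset_insert _ (hAσ i hi)
      · exact (hAσ i hi).trans (Finset.subset_insert _ _)
    · intro μ' hμ'
      split_ifs at hμ' with h
      · obtain rfl : μ.erase (f i) = μ' := by simpa using hμ'
        rw [if_neg (by omega), hsubset]
        intro j hj
        refine Finset.mem_erase.2 ⟨fun h => hj.ne (hf (show j < M by omega) hi h), ?_⟩
        exact (hfμmem j (by omega)).2 (by omega)
      · simp at hμ'
    · intro μ' hμ'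
      split_ifs at hμ' with h
      · obtain rfl : μ.erase (f i) = μ' := by simpa using hμ'
        refine Finset.ssubset_iff_subset_ne.2 ⟨?_, fun h => ?_⟩
        · exact (Finset.erase_subset_erase _ (hμθ.1.trans hθ)).trans (Finset.subset_insert _ _)
        · rw [h] at hcardμ
          omega
      · simp at hμ'
    · intro μ' hμ'
      split_ifs at hμ' with h
      · obtain rfl : μ.erase (f i) = μ' := by simpa using hμ'
        exact hcardμ
      · simp at hμ'
  choose t ht using htile
  have hbasic : ∀ i < M, ¬ (k ≤ i ∧ i ≤ l + 1) → (t i).IsBasic := fun i hi h => by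
    rw [MorseTile.IsBasic, (ht i hi).2.2, if_neg h]
  have hres_ne : ∀ i < M, (t i).res ≠ (t i).simplex := by
    intro i hi h
    obtain ⟨hs, hr, -⟩ := ht i hi
    rw [hs, hr] at h
    split_ifs at h with hik
    · have := congrArg Finset.card h
      rw [hcardσ i hi, Finset.card_insert_of_notMem (hvA i hi.le), hcardA i hi.le] at this
      omega
    · exact hvA i hi.le (h ▸ Finset.mem_insert_self _ _)
  have hface : ∀ i < M, ∀ τ, τ ∈ (t i).faceSet ↔
      τ ∈ T.stellarSub θ v ∧ (∀ j < i, f j ∈ τ) ∧ f i ∉ τ := by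
    intro i hi τ
    obtain ⟨hs, hr, hm⟩ := ht i hi
    have hsub : τ ⊆ insert v (T.simplex.erase (f i)) ↔ τ ⊆ insert v T.simplex ∧ f i ∉ τ := by
      rw [← Finset.erase_insert_of_ne (hfv i hi).symm, Finset.subset_erase]
    have hθτ : f i ∉ τ → ¬ θ ⊆ τ := fun h h' => h (h' (hfθmem i hi))
    rw [MorseTile.mem_stellarSub_iff hmorse hθ hμθ hv]
    by_cases hmid : k ≤ i ∧ i ≤ l + 1
    · rw [if_pos hmid] at hm
      rw [if_neg (by omega)] at hr
      rw [MorseTile.mem_faceSet_of_morse_eq_some hm, hs, hr, hsub, hsubset, Finset.subset_erase]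
      have hR : (∀ j < i, f j ∈ τ) → T.res ⊆ τ := fun h => by
        rw [← hfR, hsubset]
        exact fun j hj => h j (by omega)
      constructor
      · rintro ⟨⟨h1, h2⟩, h3, h4⟩
        exact ⟨⟨h1, hθτ h2, fun _ => ⟨hR h3, fun h => h4 ⟨h, h2⟩⟩⟩, h3, h2⟩
      · rintro ⟨⟨h1, -, h4⟩, h3, h2⟩
        exact ⟨⟨h1, h2⟩, h3, fun h => (h4 fun h' => hvμ (h.1 h')).2 h.1⟩
    · rw [if_neg hmid] at hm
      rw [MorseTile.mem_faceSet_of_morse_eq_none hm, hs, hr, hsub]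
      by_cases hik : i < k
      · have hR : T.res ⊆ τ → f i ∈ τ := fun h => h (hfRmem i hik)
        rw [if_pos hik, Finset.insert_subset_iff, hsubset]
        constructor
        · rintro ⟨⟨h1, h2⟩, ⟨h3, h4⟩, -⟩
          exact ⟨⟨h1, hθτ h2, fun h => absurd h3 h⟩, h4, h2⟩
        · rintro ⟨⟨h1, -, h4⟩, h3, h2⟩
          have hvτ : v ∈ τ := by_contra fun h => h2 (hR (h4 h).1)
          exact ⟨⟨h1, h2⟩, ⟨hvτ, h3⟩, Finset.ne_empty_of_mem hvτ⟩
      · rw [if_neg hik, hsubset]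
        have hR : (∀ j < i, f j ∈ τ) → T.res ⊆ τ := fun h => by
          rw [← hfR, hsubset]
          exact fun j hj => h j (by omega)
        have hμτ : (∀ j < i, f j ∈ τ) → ¬ τ ⊆ μ := fun h h' =>
          absurd ((hfμmem (l + 1) hlM).1 (h' (h (l + 1) (by omega)))) (lt_irrefl _)
        have hne : (∀ j < i, f j ∈ τ) → τ ≠ ∅ := fun h =>
          Finset.ne_empty_of_mem (h 0 (by omega))
        constructor
        · rintro ⟨⟨h1, h2⟩, h3, -⟩
          exact ⟨⟨h1, hθτ h2, fun _ => ⟨hR h3, hμτ h3⟩⟩, h3, h2⟩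
        · rintro ⟨⟨h1, -, -⟩, h3, h2⟩
          exact ⟨⟨h1, h2⟩, h3, hne h3⟩
  have hcrit : ∀ i, l ≤ i → i ≤ l + 1 → (t i).IsCritical ∧ (t i).index = i := by
    intro i h1 h2
    have hi : i < M := by omega
    obtain ⟨hs, hr, hm⟩ := ht i hi
    rw [if_neg (by omega)] at hr
    rw [if_pos (by omega)] at hm
    refine ⟨Or.inl ?_, ?_⟩
    · rw [hm, hr]
      have hsub : (Finset.range i).image f ⊆ μ.erase (f i) := by
        rw [hsubset]
        intro j hj
        refine Finset.mem_erase.2 ⟨fun h => hj.ne (hf (show j < M by omega) hi h), ?_⟩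
        exact (hfμmem j (by omega)).2 (by omega)
      refine congrArg some (Finset.eq_of_subset_of_card_le hsub ?_).symm
      rw [hcardA i hi.le, Finset.card_erase_eq_ite, hl]
      split_ifs with h
      · omega
      · rw [hfμmem i hi] at h
        omega
    · rw [MorseTile.index, if_neg (hres_ne i hi), hr, hcardA i hi.le]
  refine ⟨(List.range M).map t, t l, t (l + 1), (List.range' k (l - k)).map t,
    (List.range k ++ List.range' (l + 2) (M - (l + 2))).map t,
    isMorseShelling_of_first_missing_vertex f M n t hface ?_ ?_, ?_,
    (hcrit l le_rfl (by omega)).1, (hcrit l le_rfl (by omega)).2,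
    (hcrit (l + 1) (by omega) le_rfl).1, (hcrit (l + 1) (by omega) le_rfl).2, ?_, ?_, ?_⟩
  · intro i hi
    rw [MorseTile.dim, (ht i hi).1, hcardσ i hi]
    exact hdim
  · intro τ hτ
    have h := ((MorseTile.mem_stellarSub_iff hmorse hθ hμθ hv τ).1 hτ).2.1
    rw [← hfθ, hsubset] at h
    push Not at h
    exact h
  · rw [← List.map_append, ← List.map_cons, ← List.map_cons]
    refine List.Perm.map t ?_
    refine (List.perm_ext_iff_of_nodup List.nodup_range ?_).2 fun i => ?_
    · simp only [List.nodup_cons, List.nodup_append, List.nodup_range,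
        fun s m : ℕ => List.nodup_range' (s := s) (n := m) 1, List.mem_cons,
        List.mem_append, List.mem_range, List.mem_range'_1, true_and]
      refine ⟨by omega, by omega, ?_, ?_⟩ <;> intros <;> omega
    · simp only [List.mem_cons, List.mem_append, List.mem_range, List.mem_range'_1]
      omega
  · intro T' hT'
    obtain ⟨i, hi, rfl⟩ := List.mem_map.1 hT'
    rw [List.mem_range'_1] at hi
    have hiM : i < M := by omega
    obtain ⟨hs, hr, hm⟩ := ht i hiM
    rw [if_neg (by omega)] at hr
    rw [if_pos (by omega)] at hm
    have hcard : (μ.erase (f i)).card = l := by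
      rw [Finset.card_erase_of_mem ((hfμmem i hiM).2 (by omega)), hl, Nat.add_sub_cancel]
    refine ⟨?_, ?_, ?_⟩
    · rintro (h | h)
      · rw [hm, hr] at h
        have := congrArg Finset.card (Option.some.inj h)
        rw [hcard, hcardA i hiM.le] at this
        omega
      · exact hres_ne i hiM h
    · rw [MorseTile.IsBasic, hm]
      simp
    · intro μ' hμ'
      rw [hm] at hμ'
      obtain rfl : μ.erase (f i) = μ' := by simpa using hμ'
      exact hcard
  · refine List.Perm.of_eq ?_
    rw [List.map_map]
    refine (List.map_congr_left fun i hi => ?_).trans (List.map_id _)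
    rw [List.mem_range'_1] at hi
    rw [Function.comp_apply, MorseTile.order, (ht i (by omega)).2.1, if_neg (by omega),
      hcardA i (by omega), id]
  · intro T' hT'
    obtain ⟨i, hi, rfl⟩ := List.mem_map.1 hT'
    simp only [List.mem_append, List.mem_range, List.mem_range'_1] at hi
    have hiM : i < M := by omega
    have hb := hbasic i hiM (by omega)
    refine ⟨hb, ?_⟩
    rintro (h | h)
    · rw [show (t i).morse = none from hb] at h
      simp at h
    · exact hres_ne i hiM h
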